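/- Let G be a group, θ an involution of G, elements g_i, g_j, s ∈ G, integers t and k, and signs ε, δ ∈ {1, −1}. Assume s⁻¹·θ(g_j)·s = g_i^ε, set g := g_i^t and h := s·g_i^k, and assume g_j^(ε·t) = g^δ. Then in W(G) one has ((θ(h), h), σ) · ((g, θ(g)), 0) = ((g^δ, θ(g)^δ), 0) · ((θ(h), h), σ); equivalently, h·g·h⁻¹ = θ(g)^δ. -/

import Mathlib

/-- Permutation action of `Equiv.Perm (Fin n)` on the direct power `Fin n → G`:
`(σ • f) i = f (σ⁻¹ i)`. -/
def permAut (G : Type*) [Group G] (n : ℕ) :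
    Equiv.Perm (Fin n) →* MulAut (Fin n → G) where
  toFun σ :=
    { toFun := fun f i => f (σ.symm i)
      invFun := fun f i => f (σ i)
      left_inv := fun f => funext fun i => by simp
      right_inv := fun f => funext fun i => by simp
      map_mul' := fun f g => rfl }
  map_one' := rfl
  map_mul' := fun σ τ => rfl

/-- `W(G) = (G × G) ⋊ C₂`, encoded as `(Fin 2 → G) ⋊ Equiv.Perm (Fin 2)`, where the
nontrivial element `σ = Equiv.swap 0 1` acts by exchanging the two factors.  An element
`((u, v), ε)` is `⟨![u, v], ε⟩`. -/
abbrev W (G : Type*) [Group G] :=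
  SemidirectProduct (Fin 2 → G) (Equiv.Perm (Fin 2)) (permAut G 2)

/-- Let `G` be a group, `θ` an involution of `G`, elements
`gᵢ, gⱼ, s ∈ G`, integers `t`, `k`, and signs `ε, δ ∈ {1, −1}`.  Assume
`s⁻¹ θ(gⱼ) s = gᵢ^ε`, set `g := gᵢ^t` and `h := s gᵢ^k`, and assume `gⱼ^(εt) = g^δ`.
Then in `W(G)` one has
`((θ h, h), σ) · ((g, θ g), 0) = ((g^δ, θ(g)^δ), 0) · ((θ h, h), σ)`;
equivalently, `h g h⁻¹ = θ(g)^δ`. -/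
theorem stmt19 {G : Type*} [Group G] (θ : G →* G) (hθ : ∀ a : G, θ (θ a) = a)
    (gi gj s : G) (t k ε δ : ℤ)
    (hε : ε = 1 ∨ ε = -1) (hδ : δ = 1 ∨ δ = -1)
    (hs : s⁻¹ * θ gj * s = gi ^ ε)
    (g h : G) (hgdef : g = gi ^ t) (hhdef : h = s * gi ^ k)
    (hgj : gj ^ (ε * t) = g ^ δ) :
    ((⟨![θ h, h], Equiv.swap 0 1⟩ : W G) * SemidirectProduct.inl ![g, θ g]
        = SemidirectProduct.inl ![g ^ δ, (θ g) ^ δ] *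
          (⟨![θ h, h], Equiv.swap 0 1⟩ : W G)) ∧
    h * g * h⁻¹ = (θ g) ^ δ := by
  have hεε : ε * (ε * t) = t := by rcases hε with rfl | rfl <;> ring
  have hθgj : θ gj = s * gi ^ ε * s⁻¹ := by rw [← hs]; group
  have hconj : s * g * s⁻¹ = θ g ^ δ := by
    rw [← map_zpow, ← hgj, map_zpow, hθgj, conj_zpow, ← zpow_mul, hεε, hgdef]
  have hcomm : gi ^ k * g = g * gi ^ k := by
    rw [hgdef, ← zpow_add, ← zpow_add, add_comm]
  have hg : h * g = θ g ^ δ * h := by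
    rw [← hconj, hhdef, mul_assoc, hcomm]; group
  have hθhg : θ h * θ g = g ^ δ * θ h := by
    simpa [map_zpow, hθ] using congrArg θ hg
  refine ⟨?_, by rw [hg, mul_inv_cancel_right]⟩
  ext i
  · fin_cases i
    · exact hθhg
    · exact hg
  · simp
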